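/- For any sl₂(ℂ)-module X on which the Casimir Ω acts as the scalar λ² and any finite-dimensional sl₂-module V, the tensor product X ⊗ V is annihilated by the product ∏_ν (Ω − (λ+ν)²), where ν ranges over the weights of V (with H acting semisimply on V with integer eigenvalues ν). -/

import Mathlib

open scoped TensorProduct

/-- The Casimir operator `Ω = H² + 1 + 2EF + 2FE` built from a triple of operators. -/
noncomputable def casimirOf {M : Type*} [AddCommGroup M] [Module ℂ M]
    (H E F : Module.End ℂ M) : Module.End ℂ M :=
  H * H + 1 + 2 * (E * F) + 2 * (F * E)

/-- The diagonal action on a tensor product: `x ⊗ 1 + 1 ⊗ x`. -/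
noncomputable def diagOp {X V : Type*} [AddCommGroup X] [Module ℂ X]
    [AddCommGroup V] [Module ℂ V] (TX : Module.End ℂ X) (TV : Module.End ℂ V) :
    Module.End ℂ (X ⊗[ℂ] V) :=
  TensorProduct.map TX LinearMap.id + TensorProduct.map LinearMap.id TV

section Helpers

open Polynomial Finset

def ff {R : Type*} [CommRing R] (l h p : R) (i : ℕ) : R := -2 * (p - i) * (l - h - 1 - 2 * i)

def gg {R : Type*} [CommRing R] (l h p : R) (k j : ℕ) : R :=
  (k.choose j : R) * 4 ^ j * ∏ i ∈ Ico j k, ff l h p i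

def dd {R : Type*} [CommRing R] (l h p : R) (j : ℕ) : R :=
  l ^ 2 + 2 * (p - 2 * j) * (h + 2 * j + 1) + (p - 2 * j) ^ 2 + 4 * j * (p - j + 1)

def uu {R : Type*} [CommRing R] (l h p : R) (j : ℕ) : R :=
  (j + 1) * (p - j) * (l ^ 2 - (h + 2 * j + 1) ^ 2)

lemma gg_last {R : Type*} [CommRing R] (l h p : R) (k j : ℕ) :
    uu l h p j * gg l h p k (j+1) = -2 * ((k:R) - j) * (l + h + 1 + 2 * j) * gg l h p k j := by
  rcases lt_or_ge j k with hjk | hjk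
  · have h1 : ((j:R) + 1) * (k.choose (j+1) : R) = ((k:R) - j) * k.choose j := by
      have := Nat.choose_succ_right_eq k j
      have := congrArg (Nat.cast : ℕ → R) this
      push_cast [Nat.cast_sub hjk.le] at this
      linear_combination this
    unfold gg uu
    rw [Finset.prod_eq_prod_Ico_succ_bot hjk, ff]
    linear_combination (p - j) * (l ^ 2 - (h + 2 * j + 1) ^ 2) * 4 ^ (j+1) * (∏ i ∈ Ico (j+1) k, ff l h p i) * h1
  · rcases eq_or_lt_of_le hjk with rfl | hjk
    · simp [gg]
    · simp [gg, Nat.choose_eq_zero_of_lt hjk, Nat.choose_eq_zero_of_lt (hjk.trans (Nat.lt_succ_self _))]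

lemma gg_zero {R : Type*} [CommRing R] (l h p : R) (k : ℕ) :
    dd l h p 0 * gg l h p k 0 + uu l h p 0 * gg l h p k 1
      = (l + p - 2 * k) ^ 2 * gg l h p k 0 + gg l h p (k+1) 0 := by
  rw [gg_last]
  have : gg l h p (k+1) 0 = ff l h p k * gg l h p k 0 := by
    unfold gg
    rw [Finset.prod_Ico_succ_top (Nat.zero_le _)]; simp; ring
  rw [this, ff, dd]; push_cast; ring

lemma gg_succ {R : Type*} [CommRing R] (l h p : R) (k j : ℕ) :
    dd l h p (j+1) * gg l h p k (j+1) + 4 * gg l h p k j + uu l h p (j+1) * gg l h p k (j+2)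
      = (l + p - 2 * k) ^ 2 * gg l h p k (j+1) + gg l h p (k+1) (j+1) := by
  rw [gg_last]
  rcases lt_or_ge j k with hjk | hjk
  · have h1 : ((j:R) + 1) * (k.choose (j+1) : R) = ((k:R) - j) * k.choose j := by
      have := Nat.choose_succ_right_eq k j
      have := congrArg (Nat.cast : ℕ → R) this
      push_cast [Nat.cast_sub hjk.le] at this
      linear_combination this
    unfold gg dd
    rw [Finset.prod_eq_prod_Ico_succ_bot hjk, Finset.prod_Ico_succ_top (by omega), Nat.choose_succ_succ]
    generalize (∏ i ∈ Ico (j+1) k, ff l h p i) = Q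
    unfold ff
    push_cast
    rw [pow_succ (4:R) j]
    generalize (4:R)^j = Z
    generalize (k.choose (j+1) : R) = A at *
    generalize (k.choose j : R) = B at *
    linear_combination Z * Q * 8 * (2*p+l-h-1-2*k-2*j)*h1
  · rcases eq_or_lt_of_le hjk with rfl | hjk
    · simp [gg]; ring
    · simp [gg, Nat.choose_eq_zero_of_lt hjk, Nat.choose_eq_zero_of_lt (hjk.trans (Nat.lt_succ_self _)),
        Nat.choose_eq_zero_of_lt (Nat.succ_lt_succ hjk)]

lemma abs_step {R M : Type*} [CommRing R] [AddCommGroup M] [Module R M] (l h p : R)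
    (e : ℕ → M) (Om : M →ₗ[R] M) (h0 : Om (e 0) = dd l h p 0 • e 0 + (4:R) • e 1)
    (hs : ∀ j, Om (e (j+1)) = dd l h p (j+1) • e (j+1) + (4:R) • e (j+2) + uu l h p j • e j) (k : ℕ) :
    Om (∑ j ∈ range (k+1), gg l h p k j • e j) =
      (l + p - 2 * k) ^ 2 • (∑ j ∈ range (k+1), gg l h p k j • e j)
      + ∑ j ∈ range (k+2), gg l h p (k+1) j • e j := by
  have z : ∀ k j, k < j → gg l h p k j = 0 := fun k j hjk => by
    simp [gg, Nat.choose_eq_zero_of_lt hjk]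
  have key : ∀ N, Om (∑ j ∈ range (N+1), gg l h p k j • e j) =
      (l + p - 2 * k) ^ 2 • (∑ j ∈ range (N+1), gg l h p k j • e j)
      + ∑ j ∈ range (N+1), gg l h p (k+1) j • e j + (4 * gg l h p k N) • e (N+1)
       - (uu l h p N * gg l h p k (N+1)) • e N := by
    intro N
    induction N with
    | zero =>
      simp only [zero_add, sum_range_one, map_smul, h0]
      have := gg_zero l h p k
      have := congrArg (· • e 0) this
      simp only [add_smul] at this
      linear_combination (norm := module) this
    | succ N ih =>
      rw [sum_range_succ, map_add, ih, sum_range_succ _ (N+1), map_smul, hs]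
      have := gg_succ l h p k N
      have := congrArg (· • e (N+1)) this
      simp only [add_smul] at this
      linear_combination (norm := module) this
  have := key (k+1)
  rw [sum_range_succ _ (k+1), z k (k+1) (by omega), z k (k+1+1) (by omega)] at this
  simpa using this

open Module.End in
lemma gen_nonzero {V : Type*} [AddCommGroup V] [Module ℂ V] (H : Module.End ℂ V)
    (v : V) (hv : v ≠ 0) (μ : ℂ) (h : v ∈ H.maxGenEigenspace μ) (q : ℂ[X]) (hq : aeval H q = 0) :
    q.eval μ = 0 := by
  by_contra hne
  obtain ⟨k, hk⟩ := (mem_maxGenEigenspace H μ v).1 h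
  have hc : IsCoprime (X - C μ) q := by
    refine (Irreducible.coprime_iff_not_dvd (irreducible_X_sub_C μ)).2 ?_
    rwa [dvd_iff_isRoot]
  obtain ⟨a, b, hab⟩ := (hc.pow_left (m := k))
  have := congrArg (fun r => aeval H r v) hab
  simp only [map_add, map_mul, hq, mul_zero, add_zero, map_pow, map_sub, aeval_X, aeval_C, map_one, Module.End.mul_apply, Algebra.algebraMap_eq_smul_one, hk, map_zero, Module.End.one_apply] at this
  exact hv this.symm

open Module.End in
lemma gen_shift {V : Type*} [AddCommGroup V] [Module ℂ V] (H F : Module.End ℂ V) (c : ℂ)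
    (hF : H * F - F * H = c • F) (v : V) (μ : ℂ) (h : v ∈ H.maxGenEigenspace μ) (n : ℕ) :
    (F ^ n) v ∈ H.maxGenEigenspace (μ + n * c) := by
  induction n with
  | zero => simpa using h
  | succ n ih =>
    obtain ⟨k, hk⟩ := (mem_maxGenEigenspace _ _ _).1 ih
    refine (mem_maxGenEigenspace _ _ _).2 ⟨k, ?_⟩
    have : SemiconjBy F (H - (μ + n * c) • 1) (H - (μ + (n+1:ℕ) * c) • 1) := by
      rw [SemiconjBy, mul_sub, sub_mul, eq_add_of_sub_eq hF]
      simp only [mul_smul_comm, smul_mul_assoc, mul_one, one_mul]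
      push_cast
      module
    have := (this.pow_right k).eq
    have := congrArg (fun r => r ((F^n) v)) this
    simp only [Module.End.mul_apply, hk, map_zero] at this
    rw [pow_succ', Module.End.mul_apply]; exact this.symm

lemma gen_nilp {V : Type*} [AddCommGroup V] [Module ℂ V] (H F : Module.End ℂ V) (c : ℂ) (hc : c ≠ 0)
    (hF : H * F - F * H = c • F) (v : V) (μ : ℂ) (h : v ∈ H.maxGenEigenspace μ)
    (q : ℂ[X]) (hq0 : q ≠ 0) (hq : aeval H q = 0) : ∃ N, ∀ n, N ≤ n → (F ^ n) v = 0 := by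
  suffices ∃ n, (F ^ n) v = 0 by
    obtain ⟨N, hN⟩ := this
    refine ⟨N, fun n hn => ?_⟩
    obtain ⟨m, rfl⟩ := Nat.exists_eq_add_of_le hn
    rw [add_comm, pow_add, Module.End.mul_apply, hN, map_zero]
  by_contra! hne
  have hr : ∀ n : ℕ, (μ + n * c) ∈ q.roots.toFinset := fun n => by
    rw [Multiset.mem_toFinset, mem_roots hq0]
    exact gen_nonzero H _ (hne n) _ (gen_shift H F c hF v μ h n) q hq
  refine Set.infinite_of_injective_forall_mem (f := fun n : ℕ => μ + n * c) ?_ hr (Finset.finite_toSet _)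
  intro a b hab
  simpa [hc] using hab

/-- E^n F^n on ker E -/
lemma EF_pow {V : Type*} [AddCommGroup V] [Module ℂ V] (H E F : Module.End ℂ V)
    (h1 : E * F - F * E = H) (h2 : H * E - E * H = (2:ℂ) • E) (h3 : H * F - F * H = (-2:ℂ) • F) (n : ℕ) :
    E * F ^ (n+1) = F ^ (n+1) * E + ((n:ℂ)+1) • (F ^ n * (H - (n:ℂ) • 1)) := by
  induction n with
  | zero => simpa using eq_add_of_sub_eq' h1
  | succ n ih =>
    have e1 : E * F = F * E + H := eq_add_of_sub_eq' h1
    have e3 : H * F = F * H - (2:ℂ) • F := by rw [eq_add_of_sub_eq h3]; module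
    rw [pow_succ, ← mul_assoc, ih, add_mul, mul_assoc, e1, smul_mul_assoc, mul_assoc, sub_mul, e3]
    simp only [mul_add, mul_sub, mul_smul_comm, smul_mul_assoc, mul_one, one_mul, pow_succ, mul_assoc]
    push_cast
    module

lemma HF_pow {V : Type*} [AddCommGroup V] [Module ℂ V] (H F : Module.End ℂ V) (c : ℂ)
    (h3 : H * F - F * H = c • F) (n : ℕ) :
    H * F ^ n = F ^ n * H + (n * c) • F ^ n := by
  induction n with
  | zero => simp
  | succ n ih =>
    have e3 : H * F = F * H + c • F := by rw [eq_add_of_sub_eq h3]; module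
    rw [pow_succ, ← mul_assoc, ih, add_mul, mul_assoc, e3]
    simp only [mul_add, mul_smul_comm, smul_mul_assoc, mul_assoc]
    push_cast
    module

lemma EnFn {V : Type*} [AddCommGroup V] [Module ℂ V] (H E F : Module.End ℂ V)
    (h1 : E * F - F * E = H) (h2 : H * E - E * H = (2:ℂ) • E) (h3 : H * F - F * H = (-2:ℂ) • F) (n : ℕ) :
    ∀ v, E v = 0 → (E ^ n) ((F ^ n) v) = aeval H (∏ i ∈ range n, C ((i:ℂ)+1) * (X - C (i:ℂ))) v := by
  induction n with
  | zero => simp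
  | succ n ih =>
    intro v hv
    have hv' : E ((H - (n:ℂ) • 1) v) = 0 := by
      have := congrArg (fun r => r v) h2
      simp [hv] at this
      simp [this, hv]
    have := congrArg (fun r => r v) (EF_pow H E F h1 h2 h3 n)
    rw [Module.End.mul_apply] at this
    rw [pow_succ, Module.End.mul_apply, this, LinearMap.add_apply, Module.End.mul_apply, hv, map_zero, zero_add,
      LinearMap.smul_apply, map_smul, Module.End.mul_apply, ih _ hv', prod_range_succ, map_mul, Module.End.mul_apply,
      ← map_smul]
    congr 1
    rw [map_mul, aeval_C, Module.End.mul_apply, Module.algebraMap_end_apply, map_sub, aeval_X, aeval_C,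
      Algebra.algebraMap_eq_smul_one]

lemma EnFn_wt {V : Type*} [AddCommGroup V] [Module ℂ V] (H E F : Module.End ℂ V)
    (h1 : E * F - F * E = H) (h2 : H * E - E * H = (2:ℂ) • E) (h3 : H * F - F * H = (-2:ℂ) • F) (n : ℕ)
    (v) (hv : E v = 0) (μ : ℂ) (hμ : H v = μ • v) :
    (E ^ n) ((F ^ n) v) = (∏ i ∈ range n, ((i:ℂ)+1) * (μ - i)) • v := by
  rcases eq_or_ne v 0 with rfl | h0
  · simp
  rw [EnFn H E F h1 h2 h3 n v hv, Module.End.aeval_apply_of_hasEigenvector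
    (Module.End.hasEigenvector_iff.2 ⟨Module.End.mem_eigenspace_iff.2 hμ, h0⟩), eval_prod]
  simp

/-- generalized weight vectors in ker E are weight vectors -/
lemma kerE_ss {V : Type*} [AddCommGroup V] [Module ℂ V] (H E F : Module.End ℂ V)
    (h1 : E * F - F * E = H) (h2 : H * E - E * H = (2:ℂ) • E) (h3 : H * F - F * H = (-2:ℂ) • F)
    (q : ℂ[X]) (hq0 : q ≠ 0) (hq : aeval H q = 0)
    (u : V) (hu : E u = 0) (p : ℕ) (h : u ∈ H.maxGenEigenspace (p:ℂ)) : H u = (p:ℂ) • u := by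
  obtain ⟨N, hN⟩ := gen_nilp H F (-2) (by norm_num) h3 u p h q hq0 hq
  have hn := EnFn H E F h1 h2 h3 (N+p+1) u hu
  rw [hN _ (by omega), map_zero] at hn
  obtain ⟨k, hk⟩ := (Module.End.mem_maxGenEigenspace H _ u).1 h
  set r : ℂ[X] := (∏ i ∈ (range (N+p+1)).erase p, C ((i:ℂ)+1) * (X - C (i:ℂ))) with hr
  have hc : IsCoprime (X - C (p:ℂ)) r := by
    refine (Irreducible.coprime_iff_not_dvd (irreducible_X_sub_C _)).2 ?_
    rw [dvd_iff_isRoot, IsRoot, hr, eval_prod, prod_eq_zero_iff]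
    rintro ⟨i, hi, h⟩
    simp only [eval_mul, eval_C, eval_sub, eval_X, mul_eq_zero] at h
    rcases h with h | h
    · exact Nat.cast_add_one_ne_zero i h
    · have : p = i := by exact_mod_cast sub_eq_zero.1 h
      exact (mem_erase.1 hi).1 this.symm
  obtain ⟨a, b, hab⟩ := (hc.pow_left (m := k))
  rw [← prod_erase_mul _ _ (mem_range.2 (by omega : p < N+p+1)), ← hr] at hn
  have hw : aeval H (X - C (p:ℂ)) u = H u - (p:ℂ) • u := by
    rw [map_sub, aeval_X, aeval_C, LinearMap.sub_apply, Module.algebraMap_end_apply]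
  have hn' : aeval H r (aeval H (X - C (p:ℂ)) u) = 0 := by
    have e : r * (C ((p:ℂ)+1) * (X - C (p:ℂ))) = C ((p:ℂ)+1) * (r * (X - C (p:ℂ))) := by ring
    rw [e, map_mul, aeval_C, map_mul, Module.End.mul_apply, Module.End.mul_apply, Module.algebraMap_end_apply] at hn
    exact (smul_eq_zero.1 hn.symm).resolve_left (Nat.cast_add_one_ne_zero p)
  have hk' : aeval H ((X - C (p:ℂ)) ^ k) u = 0 := by
    rw [map_pow, map_sub, aeval_X, aeval_C, Algebra.algebraMap_eq_smul_one, hk]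
  have e : X - C (p:ℂ) = (a * (X - C (p:ℂ))) * (X - C (p:ℂ))^k + b * (r * (X - C (p:ℂ))) := by
    linear_combination (-(X - C (p:ℂ))) * hab
  have := congrArg (fun r => aeval H r u) e
  simp only [map_add, LinearMap.add_apply] at this
  rw [hw, map_mul, Module.End.mul_apply, hk', map_zero, zero_add, map_mul, Module.End.mul_apply, map_mul, Module.End.mul_apply, hn', map_zero] at this
  exact sub_eq_zero.1 this

/-- induction principle -/
lemma pos_weight {V : Type*} [AddCommGroup V] [Module ℂ V] (H E F : Module.End ℂ V)
    (h1 : E * F - F * E = H) (h2 : H * E - E * H = (2:ℂ) • E) (h3 : H * F - F * H = (-2:ℂ) • F)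
    (q : ℂ[X]) (hq0 : q ≠ 0) (hq : aeval H q = 0) (S : Submodule ℂ V)
    (hS : ∀ v (p : ℕ), E v = 0 → H v = (p:ℂ) • v → ∀ j, (F ^ j) v ∈ S)
    (k : ℕ) (w : V) (hw : w ∈ H.maxGenEigenspace (k:ℂ)) : w ∈ S := by
  obtain ⟨N, hN⟩ := gen_nilp H E 2 (by norm_num) h2 w k hw q hq0 hq
  replace hN := hN N le_rfl
  induction N generalizing w with
  | zero => simp at hN; simp [hN]
  | succ r ih =>
    have hu : E ((E ^ r) w) = 0 := by rw [← Module.End.mul_apply, ← pow_succ', hN]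
    have hg := gen_shift H E 2 h2 w k hw r
    have hcast : ((k:ℂ) + r * 2) = ((k + r * 2 : ℕ) : ℂ) := by push_cast; ring
    rw [hcast] at hg
    have hH := kerE_ss H E F h1 h2 h3 q hq0 hq _ hu _ hg
    have hE := EnFn_wt H E F h1 h2 h3 r _ hu _ hH
    set c := (∏ i ∈ range r, ((i:ℂ)+1) * (((k + r * 2 : ℕ) : ℂ) - i)) with hcdef
    have hc : c ≠ 0 := by
      rw [hcdef, prod_ne_zero_iff]
      intro i hi
      have hi := mem_range.1 hi
      refine mul_ne_zero (Nat.cast_add_one_ne_zero i) (sub_ne_zero.2 ?_)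
      intro h
      have : k + r * 2 = i := by exact_mod_cast h
      omega
    have hs := hS _ _ hu hH r
    have hgs := gen_shift H F (-2) h3 _ _ hg r
    have e : (((k + r * 2 : ℕ) : ℂ) + r * (-2)) = k := by push_cast; ring
    rw [e] at hgs
    have := ih (w - c⁻¹ • (F ^ r) ((E ^ r) w)) (Submodule.sub_mem _ hw (Submodule.smul_mem _ _ hgs)) ?_
    · have := S.add_mem this (S.smul_mem c⁻¹ hs)
      simpa using this
    · rw [map_sub, map_smul, hE, smul_smul, inv_mul_cancel₀ hc, one_smul, sub_self]

lemma cas_eq {M : Type*} [AddCommGroup M] [Module ℂ M] (H E F : Module.End ℂ M)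
    (h1 : E * F - F * E = H) : casimirOf H E F = H * H + 1 + (2:ℂ) • H + (4:ℂ) • (F * E) := by
  have e : E * F = F * E + H := eq_add_of_sub_eq' h1
  have t : ∀ a : Module.End ℂ M, 2 * a = (2:ℂ) • a := fun a => by rw [two_mul, two_smul]
  rw [casimirOf, e, t, t]; module

lemma cas_comm_H {M : Type*} [AddCommGroup M] [Module ℂ M] (H E F : Module.End ℂ M)
    (h1 : E * F - F * E = H) (h2 : H * E - E * H = (2:ℂ) • E) (h3 : H * F - F * H = (-2:ℂ) • F) :
    Commute (casimirOf H E F) H := by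
  rw [cas_eq H E F h1]
  have e2 : E * H = H * E - (2:ℂ) • E := by rw [← h2]; abel
  have e3 : F * H = H * F + (2:ℂ) • F := by linear_combination (norm := module) (-1 : ℂ) • h3
  have : F * E * H = H * (F * E) := by
    rw [mul_assoc, e2, mul_sub, ← mul_assoc, e3, add_mul, mul_assoc, mul_smul_comm, smul_mul_assoc]; abel
  rw [Commute, SemiconjBy]
  simp only [add_mul, mul_add, smul_mul_assoc, mul_smul_comm, this, mul_assoc, one_mul, mul_one]

lemma cas_comm_F {M : Type*} [AddCommGroup M] [Module ℂ M] (H E F : Module.End ℂ M)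
    (h1 : E * F - F * E = H) (h3 : H * F - F * H = (-2:ℂ) • F) :
    Commute (casimirOf H E F) F := by
  rw [cas_eq H E F h1]
  have e1 : E * F = F * E + H := eq_add_of_sub_eq' h1
  have e3 : H * F = F * H - (2:ℂ) • F := by rw [eq_add_of_sub_eq h3]; module
  rw [Commute, SemiconjBy]
  simp only [add_mul, mul_add, smul_mul_assoc, mul_smul_comm, mul_assoc, one_mul, mul_one, e1, e3, mul_sub]
  rw [← mul_assoc H F H, e3, sub_mul, mul_assoc, smul_mul_assoc]
  module

lemma diag_comm {W V : Type*} [AddCommGroup W] [Module ℂ W] [AddCommGroup V] [Module ℂ V]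
    (A B C : Module.End ℂ W) (A' B' C' : Module.End ℂ V) (c : ℂ)
    (h : A * B - B * A = c • C) (h' : A' * B' - B' * A' = c • C') :
    diagOp A A' * diagOp B B' - diagOp B B' * diagOp A A' = c • diagOp C C' := by
  refine TensorProduct.ext' fun x v => ?_
  have hx := congrArg (fun r => r x ⊗ₜ[ℂ] v) h
  have hv := congrArg (fun r => x ⊗ₜ[ℂ] r v) h'
  simp only [LinearMap.sub_apply, LinearMap.smul_apply, Module.End.mul_apply, TensorProduct.sub_tmul, TensorProduct.tmul_sub, TensorProduct.tmul_smul, ← TensorProduct.smul_tmul'] at hx hv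
  simp only [diagOp, LinearMap.sub_apply, LinearMap.smul_apply, LinearMap.add_apply, Module.End.mul_apply, map_add, TensorProduct.map_tmul, LinearMap.id_apply, smul_add]
  rw [← hx, ← hv]; abel

lemma diag_tmul {W V : Type*} [AddCommGroup W] [Module ℂ W] [AddCommGroup V] [Module ℂ V]
    (A : Module.End ℂ W) (A' : Module.End ℂ V) (x : W) (v : V) :
    diagOp A A' (x ⊗ₜ v) = A x ⊗ₜ v + x ⊗ₜ A' v := by
  simp [diagOp]

lemma cas_tmul {W V : Type*} [AddCommGroup W] [Module ℂ W] [AddCommGroup V] [Module ℂ V]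
    (HX EX FX : Module.End ℂ W) (HV EV FV : Module.End ℂ V)
    (hX1 : EX * FX - FX * EX = HX) (hV1 : EV * FV - FV * EV = HV)
    (lam : ℂ) (hCas : casimirOf HX EX FX = lam ^ 2 • (1 : Module.End ℂ W)) (x : W) (v : V) (μ c : ℂ)
    (hμ : HV v = μ • v) (hc : FV (EV v) = c • v) :
    casimirOf (diagOp HX HV) (diagOp EX EV) (diagOp FX FV) (x ⊗ₜ v) =
      (lam ^ 2 + 2 * μ + μ ^ 2 + 4 * c) • (x ⊗ₜ v) + (2 * μ) • (HX x ⊗ₜ[ℂ] v) + (4:ℂ) • (EX x ⊗ₜ[ℂ] FV v)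
       + (4 : ℂ) • (FX x ⊗ₜ[ℂ] EV v) := by
  have hd : diagOp EX EV * diagOp FX FV - diagOp FX FV * diagOp EX EV = diagOp HX HV := by
    simpa using diag_comm EX FX HX EV FV HV 1 (by simpa using hX1) (by simpa using hV1)
  rw [cas_eq _ _ _ hX1] at hCas
  have hx := congrArg (fun r => r x ⊗ₜ[ℂ] v) hCas
  rw [cas_eq _ _ _ hd]
  simp only [LinearMap.add_apply, LinearMap.smul_apply, Module.End.mul_apply, TensorProduct.add_tmul, TensorProduct.tmul_smul, ← TensorProduct.smul_tmul', Module.End.one_apply] at hx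
  simp only [LinearMap.add_apply, LinearMap.smul_apply, Module.End.mul_apply, Module.End.one_apply, diag_tmul, map_add, hμ, hc, TensorProduct.tmul_smul, map_smul]
  linear_combination (norm := module) hx

lemma prim_kill {W V : Type*} [AddCommGroup W] [Module ℂ W] [AddCommGroup V] [Module ℂ V]
    (HX EX FX : Module.End ℂ W) (HV EV FV : Module.End ℂ V)
    (hX1 : EX * FX - FX * EX = HX) (hX2 : HX * EX - EX * HX = (2:ℂ) • EX)
    (hX3 : HX * FX - FX * HX = (-2 : ℂ) • FX)
    (hV1 : EV * FV - FV * EV = HV) (hV2 : HV * EV - EV * HV = (2:ℂ) • EV)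
    (hV3 : HV * FV - FV * HV = (-2 : ℂ) • FV)
    (lam : ℂ) (hCas : casimirOf HX EX FX = lam ^ 2 • (1 : Module.End ℂ W))
    (p : ℕ) (v : V) (hv : EV v = 0) (hp : HV v = (p:ℂ) • v) (hF : (FV ^ (p+1)) v = 0) (x : W) :
    aeval (casimirOf (diagOp HX HV) (diagOp EX EV) (diagOp FX FV))
      (∏ k ∈ range (p+1), (X - C ((lam + p - 2 * k) ^ 2))) (x ⊗ₜ[ℂ] v) = 0 := by
  have d1 : diagOp EX EV * diagOp FX FV - diagOp FX FV * diagOp EX EV = diagOp HX HV := by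
    simpa using diag_comm EX FX HX EV FV HV 1 (by simpa using hX1) (by simpa using hV1)
  have d2 := diag_comm HX EX EX HV EV EV 2 hX2 hV2
  have d3 := diag_comm HX FX FX HV FV FV (-2) hX3 hV3
  set Om := casimirOf (diagOp HX HV) (diagOp EX EV) (diagOp FX FV) with hOm
  set h := diagOp HX HV - (p:ℂ) • (1 : Module.End ℂ (W ⊗[ℂ] V)) with hh
  have hcomm : Commute Om h := by
    refine Commute.sub_right (cas_comm_H _ _ _ d1 d2 d3) ?_
    exact Commute.smul_right (Commute.one_right _) _
  clear_value h
  have hpoly : ∀ r : ℂ[X], Commute Om (aeval h r) := fun r => by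
    induction r using Polynomial.induction_on' with
    | add a b ha hb => rw [map_add]; exact ha.add_right hb
    | monomial n a =>
      rw [aeval_monomial]
      exact Commute.mul_right (Algebra.commutes' a Om).symm (hcomm.pow_right n)
  let _ : Module ℂ[X] (W ⊗[ℂ] V) := Module.compHom (W ⊗[ℂ] V) (aeval h).toRingHom
  have sm : ∀ (r : ℂ[X]) (m : W ⊗[ℂ] V), r • m = aeval h r m := fun r m => rfl
  let Om' : (W ⊗[ℂ] V) →ₗ[ℂ[X]] (W ⊗[ℂ] V) :=
    { toFun := Om, map_add' := map_add Om, map_smul' := fun r m => by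
        rw [sm, RingHom.id_apply, sm, ← Module.End.mul_apply, (hpoly r).eq, Module.End.mul_apply] }
  let e : ℕ → W ⊗[ℂ] V := fun j => (EX ^ j) x ⊗ₜ (FV ^ j) v
  have hwt : ∀ j : ℕ, HV ((FV ^ j) v) = ((p:ℂ) - 2 * j) • (FV ^ j) v := fun j => by
    have := congrArg (fun r => r v) (HF_pow HV FV _ hV3 j)
    simp only [LinearMap.add_apply, LinearMap.smul_apply, Module.End.mul_apply, hp, map_smul] at this
    rw [this]; module
  have hEF : ∀ j : ℕ, EV ((FV ^ (j+1)) v) = (((j:ℂ)+1) * (p - j)) • (FV ^ j) v := fun j => by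
    have := congrArg (fun r => r v) (EF_pow HV EV FV hV1 hV2 hV3 j)
    simp only [LinearMap.add_apply, LinearMap.smul_apply, LinearMap.sub_apply, Module.End.one_apply, Module.End.mul_apply, hp, hv, map_smul, map_zero, zero_add, map_sub] at this
    rw [this]; module
  have hhe : ∀ (j : ℕ) (y : W), h (y ⊗ₜ (FV ^ j) v) = HX y ⊗ₜ (FV ^ j) v - (2 * j : ℂ) • (y ⊗ₜ[ℂ] (FV ^ j) v) := fun j y => by
    rw [hh, LinearMap.sub_apply, diag_tmul, hwt, LinearMap.smul_apply, Module.End.one_apply, TensorProduct.tmul_smul]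
    module
  have cst : ∀ c : ℂ, aeval h (C c) = c • 1 := fun c => by rw [aeval_C, Algebra.algebraMap_eq_smul_one]
  have aevh : ∀ (a b : ℂ) m, aeval h (C a * X + C b) m = a • h m + b • m := fun a b m => by
    rw [map_add, map_mul, cst, cst, aeval_X]; simp
  have h0 : Om' (e 0) = dd (C lam) X (C (p:ℂ)) 0 • e 0 + (4:ℂ[X]) • e 1 := by
    have e1 := cas_tmul HX EX FX HV EV FV hX1 hV1 lam hCas x v p 0 hp (by simp [hv])
    have e2 : dd (C lam) X (C (p:ℂ)) 0 = C (2 * (p:ℂ)) * X + C (lam^2 + 2 * p + p^2) := by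
      simp only [dd, map_mul, map_add, map_pow, map_ofNat]; push_cast; ring
    have e3 : (4:ℂ[X]) = C 0 * X + C 4 := by
      rw [map_zero, zero_mul, zero_add]; exact (map_ofNat C 4).symm
    have e4 := hhe 0 x
    rw [sm, sm, e2, e3, aevh, aevh]
    change Om _ = _
    simp only [e, pow_zero, pow_one, Module.End.one_apply, hv, TensorProduct.tmul_zero, Nat.cast_zero] at e1 e4 ⊢
    rw [e1, e4]; module
  have hs : ∀ j, Om' (e (j+1)) = dd (C lam) X (C (p:ℂ)) (j+1) • e (j+1) + (4:ℂ[X]) • e (j+2) + uu (C lam) X (C (p:ℂ)) j • e j := by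
    intro j
    have hc : FV (EV ((FV ^ (j+1)) v)) = (((j:ℂ)+1) * (p - j)) • (FV ^ (j+1)) v := by
      rw [hEF, map_smul, pow_succ' FV j, Module.End.mul_apply]
    have e1 := cas_tmul HX EX FX HV EV FV hX1 hV1 lam hCas ((EX ^ (j+1)) x) _ _ _ (hwt (j+1)) hc
    have e2 : dd (C lam) X (C (p:ℂ)) (j+1) = C (2 * ((p:ℂ) - 2 * (j+1))) * X + 
        C (lam^2 + 2 * ((p:ℂ) - 2 * (j+1)) * (2 * (j+1) + 1) + ((p:ℂ) - 2 * (j+1))^2 + 4 * (j + 1) * (p - j)) := by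
      simp only [dd, map_mul, map_add, map_sub, map_pow, map_ofNat, map_natCast, map_one]; push_cast; ring
    have e3 : (4:ℂ[X]) = C 0 * X + C 4 := by
      rw [map_zero, zero_mul, zero_add]; exact (map_ofNat C 4).symm
    have e4 := hhe (j+1) ((EX ^ (j+1)) x)
    have e5 : uu (C lam) X (C (p:ℂ)) j = C (((j:ℂ)+1) * (p - j)) * (C (lam^2) - (C 1 * X + C (2 * (j:ℂ) + 1)) * (C 1 * X + C (2 * (j:ℂ) + 1))) := by
      simp only [uu, map_mul, map_add, map_sub, map_pow, map_ofNat, map_natCast, map_one]; ring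
    have e6 := hhe j ((EX ^ j) x)
    have e7 := hhe j (HX ((EX ^ j) x))
    have hy := congrArg (fun r => r ((EX ^ j) x) ⊗ₜ[ℂ] (FV ^ j) v) hCas
    rw [cas_eq _ _ _ hX1] at hy
    simp only [LinearMap.add_apply, LinearMap.smul_apply, Module.End.mul_apply, TensorProduct.add_tmul, TensorProduct.tmul_smul, ← TensorProduct.smul_tmul', Module.End.one_apply] at hy
    rw [← Module.End.mul_apply EX, ← pow_succ'] at hy
    rw [sm, sm, sm, e2, e3, e5, aevh, aevh, map_mul, Module.End.mul_apply, map_sub, LinearMap.sub_apply, cst, cst, map_mul, Module.End.mul_apply, aevh, aevh]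
    change Om _ = _
    simp only [e]
    rw [hEF, ← Module.End.mul_apply EX, ← pow_succ', ← Module.End.mul_apply FV, ← pow_succ', TensorProduct.tmul_smul] at e1
    rw [e1, e4]
    simp only [map_add, map_smul, map_sub, e6, e7, LinearMap.smul_apply, Module.End.one_apply]
    push_cast
    linear_combination (norm := module) (((j:ℂ)+1) * (p - j)) • hy
  have main : ∀ k, aeval Om (∏ i ∈ range k, (X - C ((lam + p - 2 * i) ^ 2))) (x ⊗ₜ[ℂ] v) =
      ∑ j ∈ range (k+1), gg (C lam) X (C (p:ℂ)) k j • e j := by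
    intro k
    induction k with
    | zero => simp [gg, e]
    | succ k ih =>
      have := abs_step (C lam) X (C (p:ℂ)) e Om' h0 hs k
      rw [prod_range_succ, mul_comm, map_mul, Module.End.mul_apply, ih, map_sub, aeval_X, LinearMap.sub_apply]
      have e8 : (C lam + C (p:ℂ) - 2 * (k:ℂ[X])) ^ 2 = C ((lam + p - 2 * k) ^ 2) := by
        simp only [map_mul, map_add, map_sub, map_pow, map_ofNat, map_natCast]
      rw [e8, sm, cst] at this
      rw [aeval_C, Algebra.algebraMap_eq_smul_one]
      exact sub_eq_of_eq_add' this
  rw [main, sum_eq_zero]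
  intro j hj
  rcases eq_or_ne j (p+1) with rfl | hne
  · simp [e, hF]
  · have : gg (C lam) X (C (p:ℂ)) (p+1) j = 0 := by
      rw [gg, prod_eq_zero (i := p), mul_zero]
      · simp at hj ⊢; omega
      · simp [ff]
    rw [this, zero_smul]

lemma half {W V : Type*} [AddCommGroup W] [Module ℂ W] [AddCommGroup V] [Module ℂ V]
    (HX EX FX : Module.End ℂ W) (HV EV FV : Module.End ℂ V)
    (hX1 : EX * FX - FX * EX = HX) (hX2 : HX * EX - EX * HX = (2:ℂ) • EX)
    (hX3 : HX * FX - FX * HX = (-2 : ℂ) • FX)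
    (hV1 : EV * FV - FV * EV = HV) (hV2 : HV * EV - EV * HV = (2:ℂ) • EV)
    (hV3 : HV * FV - FV * HV = (-2 : ℂ) • FV)
    (lam : ℂ) (hCas : casimirOf HX EX FX = lam ^ 2 • (1 : Module.End ℂ W))
    {n : ℕ} (ν : Fin n → ℤ) (hq : aeval HV (∏ i, (X - C (ν i : ℂ))) = 0)
    (k : ℕ) (w : V) (hw : w ∈ HV.maxGenEigenspace (k:ℂ)) (x : W) :
    aeval (casimirOf (diagOp HX HV) (diagOp EX EV) (diagOp FX FV))
      (∏ i, (X - C ((lam + ν i) ^ 2))) (x ⊗ₜ[ℂ] w) = 0 := by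
  have d1 : diagOp EX EV * diagOp FX FV - diagOp FX FV * diagOp EX EV = diagOp HX HV := by
    simpa using diag_comm EX FX HX EV FV HV 1 (by simpa using hX1) (by simpa using hV1)
  have d3 := diag_comm HX FX FX HV FV FV (-2) hX3 hV3
  have hcF := cas_comm_F _ _ _ d1 d3
  set Om := casimirOf (diagOp HX HV) (diagOp EX EV) (diagOp FX FV) with hOm
  set Q : ℂ[X] := ∏ i, (X - C ((lam + ν i) ^ 2)) with hQ
  have hq0 : (∏ i, (X - C (ν i : ℂ))) ≠ 0 := (monic_prod_of_monic _ _ fun i _ => monic_X_sub_C _).ne_zero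
  have hcQ : Commute (aeval Om Q) (diagOp FX FV) := by
    have : ∀ r : ℂ[X], Commute (aeval Om r) (diagOp FX FV) := fun r => by
      induction r using Polynomial.induction_on' with
      | add a b ha hb => rw [map_add]; exact ha.add_left hb
      | monomial n a =>
        rw [aeval_monomial]
        exact Commute.mul_left (Algebra.commutes' a _) (hcF.pow_left n)
    exact this Q
  let S : Submodule ℂ V :=
    { carrier := {w | ∀ x : W, aeval Om Q (x ⊗ₜ[ℂ] w) = 0}
      add_mem' := fun {a b} ha hb x => by rw [TensorProduct.tmul_add, map_add, ha x, hb x, add_zero]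
      zero_mem' := fun x => by simp
      smul_mem' := fun c a ha x => by rw [TensorProduct.tmul_smul, map_smul, ha x, smul_zero] }
  suffices w ∈ S from this x
  refine pos_weight HV EV FV hV1 hV2 hV3 _ hq0 hq S ?_ k w hw
  intro v p hv hp j
  induction j with
  | succ j ih =>
    intro x
    have := congrArg (fun r => r (x ⊗ₜ[ℂ] (FV ^ j) v)) hcQ.eq
    simp only [Module.End.mul_apply, diag_tmul, map_add] at this
    rw [ih, ih, zero_add, map_zero] at this
    rw [pow_succ', Module.End.mul_apply, this]
  | zero =>
    rcases eq_or_ne v 0 with rfl | hv0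
    · simp
    have hwt : ∀ j : ℕ, HV ((FV ^ j) v) = ((p:ℂ) - 2 * j) • (FV ^ j) v := fun j => by
      have := congrArg (fun r => r v) (HF_pow HV FV _ hV3 j)
      simp only [LinearMap.add_apply, LinearMap.smul_apply, Module.End.mul_apply, hp, map_smul] at this
      rw [this]; module
    have hF : (FV ^ (p+1)) v = 0 := by
      by_contra hne
      have hE : EV ((FV ^ (p+1)) v) = 0 := by
        have := congrArg (fun r => r v) (EF_pow HV EV FV hV1 hV2 hV3 p)
        simpa only [LinearMap.add_apply, LinearMap.smul_apply, LinearMap.sub_apply, Module.End.one_apply, Module.End.mul_apply, hp, hv, map_smul, map_zero, zero_add, map_sub, sub_self, smul_zero] using this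
      obtain ⟨N, hN⟩ := gen_nilp HV FV (-2) (by norm_num) hV3 v p
        ((Module.End.mem_maxGenEigenspace _ _ _).2 ⟨1, by simp [hp]⟩) _ hq0 hq
      have := EnFn_wt HV EV FV hV1 hV2 hV3 N _ hE _ (hwt (p+1))
      rw [← Module.End.mul_apply (FV ^ N), ← pow_add, hN _ (by omega), map_zero] at this
      refine (smul_ne_zero ?_ hne) this.symm
      rw [prod_ne_zero_iff]
      intro i _
      refine mul_ne_zero (Nat.cast_add_one_ne_zero i) fun h => ?_
      have : (p:ℤ) - 2 * (p+1) - i = 0 := by exact_mod_cast h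
      omega
    have hex : ∀ j : Fin (p+1), ∃ i, ν i = (p:ℤ) - 2 * (j:ℕ) := by
      intro j
      have hne : (FV ^ (j:ℕ)) v ≠ 0 := by
        intro h0
        have := EnFn_wt HV EV FV hV1 hV2 hV3 j _ hv _ hp
        rw [h0, map_zero] at this
        refine (smul_ne_zero ?_ hv0) this.symm
        rw [prod_ne_zero_iff]
        intro i hi
        refine mul_ne_zero (Nat.cast_add_one_ne_zero i) fun h => ?_
        have h : (p:ℤ) - i = 0 := by exact_mod_cast h
        have := mem_range.1 hi
        omega
      have := gen_nonzero HV _ hne _ ((Module.End.mem_maxGenEigenspace _ _ _).2 ⟨1, by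
        rw [pow_one, LinearMap.sub_apply, hwt, LinearMap.smul_apply, Module.End.one_apply, sub_self]⟩) _ hq
      rw [eval_prod, prod_eq_zero_iff] at this
      obtain ⟨i, _, hi⟩ := this
      refine ⟨i, ?_⟩
      simp only [eval_sub, eval_X, eval_C] at hi
      have : (p:ℤ) - 2 * (j:ℕ) - ν i = 0 := by exact_mod_cast hi
      omega
    choose f hf using hex
    have hinj : Function.Injective f := fun a b hab => by
      have h1 := hf a
      have h2 := hf b
      rw [hab] at h1
      ext; omega
    have hdvd : (∏ k ∈ range (p+1), (X - C ((lam + p - 2 * k) ^ 2))) ∣ Q := by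
      have : (∏ k ∈ range (p+1), (X - C ((lam + p - 2 * k) ^ 2))) = ∏ i ∈ univ.image f, (X - C ((lam + ν i) ^ 2)) := by
        rw [prod_image fun a _ b _ h => hinj h, prod_range]
        refine prod_congr rfl fun j _ => ?_
        rw [hf]; push_cast; ring_nf
      rw [this, hQ]
      exact prod_dvd_prod_of_subset _ _ _ (subset_univ _)
    obtain ⟨r, hr⟩ := hdvd
    intro x
    rw [hr, mul_comm, map_mul, Module.End.mul_apply, pow_zero, Module.End.one_apply,
      prim_kill HX EX FX HV EV FV hX1 hX2 hX3 hV1 hV2 hV3 lam hCas p v hv hp hF, map_zero]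

lemma aux_list {M : Type*} [AddCommGroup M] [Module ℂ M] {n : ℕ} (A : Module.End ℂ M) (f : Fin n → ℂ) :
    (List.ofFn fun i => A - f i • (1 : Module.End ℂ M)).prod = aeval A (∏ i, (X - C (f i))) := by
  rw [← List.prod_ofFn, map_list_prod, List.map_ofFn]
  congr 2
  ext1 i
  simp [Algebra.algebraMap_eq_smul_one]

lemma aux_neg {M : Type*} [AddCommGroup M] [Module ℂ M] (H E F : Module.End ℂ M) :
    casimirOf (-H) F E = casimirOf H E F := by
  rw [casimirOf, casimirOf, neg_mul_neg]; abel

end Helpers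

open Polynomial Finset in
/-- Kostant's theorem for sl₂: if `X` is an sl₂(ℂ)-module on which the Casimir `Ω` acts
as the scalar `λ²`, and `V` is a finite-dimensional sl₂-module on which `H` acts
semisimply with integer eigenvalues (the weights `ν i`, listed with multiplicity), then the
Casimir of the diagonal sl₂-action on `X ⊗ V` is annihilated by
`∏_i (Ω − (λ+νᵢ)²)`. -/
theorem kostant_tensor_Z_finiteness
    {X V : Type*} [AddCommGroup X] [Module ℂ X] [AddCommGroup V] [Module ℂ V]
    [FiniteDimensional ℂ V]
    (HX EX FX : Module.End ℂ X) (HV EV FV : Module.End ℂ V)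
    (hX1 : EX * FX - FX * EX = HX) (hX2 : HX * EX - EX * HX = 2 • EX)
    (hX3 : HX * FX - FX * HX = (-2 : ℤ) • FX)
    (hV1 : EV * FV - FV * EV = HV) (hV2 : HV * EV - EV * HV = 2 • EV)
    (hV3 : HV * FV - FV * HV = (-2 : ℤ) • FV)
    (lam : ℂ) (hCas : casimirOf HX EX FX = lam ^ 2 • (1 : Module.End ℂ X))
    {n : ℕ} (ν : Fin n → ℤ)
    (hsemisimple : (List.ofFn fun i => HV - (ν i : ℂ) • (1 : Module.End ℂ V)).prod = 0) :
    (List.ofFn fun i => casimirOf (diagOp HX HV) (diagOp EX EV) (diagOp FX FV)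
        - ((lam + ν i) ^ 2) • (1 : Module.End ℂ (X ⊗[ℂ] V))).prod = 0 := by
  have hX2' : HX * EX - EX * HX = (2:ℂ) • EX := by rw [hX2]; module
  have hX3' : HX * FX - FX * HX = (-2:ℂ) • FX := by rw [hX3]; module
  have hV2' : HV * EV - EV * HV = (2:ℂ) • EV := by rw [hV2]; module
  have hV3' : HV * FV - FV * HV = (-2:ℂ) • FV := by rw [hV3]; module
  rw [aux_list] at hsemisimple ⊢
  refine TensorProduct.ext' fun x w => ?_
  rw [LinearMap.zero_apply]
  have hq0 : (∏ i, (Polynomial.X - C (ν i : ℂ))) ≠ 0 := (monic_prod_of_monic _ _ fun i _ => monic_X_sub_C _).ne_zero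
  have hwtop : w ∈ ⨆ μ, HV.maxGenEigenspace μ := by
    rw [Module.End.iSup_maxGenEigenspace_eq_top]; trivial
  refine Submodule.iSup_induction _ hwtop (motive := fun w => aeval (casimirOf (diagOp HX HV) (diagOp EX EV) (diagOp FX FV))
      (∏ i, (Polynomial.X - C ((lam + ν i) ^ 2))) (x ⊗ₜ[ℂ] w) = 0) ?_ (by simp) ?_
  · intro μ w hw
    rcases eq_or_ne w 0 with rfl | hw0
    · simp
    have := gen_nonzero HV w hw0 μ hw _ hsemisimple
    rw [eval_prod, prod_eq_zero_iff] at this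
    obtain ⟨i, _, hi⟩ := this
    simp only [eval_sub, eval_X, eval_C] at hi
    obtain rfl := sub_eq_zero.1 hi
    rcases Int.eq_nat_or_neg (ν i) with ⟨k, hk | hk⟩
    · refine half HX EX FX HV EV FV hX1 hX2' hX3' hV1 hV2' hV3' lam hCas ν hsemisimple k w ?_ x
      rw [hk] at hw; simpa using hw
    · have nd : diagOp (-HX) (-HV) = - diagOp HX HV := by
        refine TensorProduct.ext' fun x w => ?_
        rw [LinearMap.neg_apply, diag_tmul, diag_tmul]
        simp [TensorProduct.neg_tmul, TensorProduct.tmul_neg]; abel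
      have hq' : aeval (-HV) (∏ i, (Polynomial.X - C ((-ν i : ℤ) : ℂ))) = 0 := by
        rw [← aux_list] at hsemisimple ⊢
        have e : (fun i => -HV - (((-ν i : ℤ) : ℂ)) • (1 : Module.End ℂ V))
            = fun i => -(HV - (ν i : ℂ) • (1 : Module.End ℂ V)) := by
          ext1 i; push_cast; module
        rw [e]
        have : ∀ l : List (Module.End ℂ V), l.prod = 0 → (l.map Neg.neg).prod = 0 := fun l hl => by
          rw [List.prod_map_neg, hl, mul_zero]
        have := this _ hsemisimple
        rwa [List.map_ofFn] at this
      have := half (-HX) FX EX (-HV) FV EV (by rw [← hX1]; abel)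
        (by linear_combination (norm := (simp only [neg_mul, mul_neg]; module)) (-1:ℂ) • hX3')
        (by linear_combination (norm := (simp only [neg_mul, mul_neg]; module)) (-1:ℂ) • hX2')
        (by rw [← hV1]; abel)
        (by linear_combination (norm := (simp only [neg_mul, mul_neg]; module)) (-1:ℂ) • hV3')
        (by linear_combination (norm := (simp only [neg_mul, mul_neg]; module)) (-1:ℂ) • hV2')
        (-lam) (by rw [aux_neg, hCas, neg_sq]) (fun i => - ν i) hq' k w ?_ x
      · rw [nd, aux_neg] at this
        convert this using 6
        push_cast; ring
      · obtain ⟨s, hs⟩ := (Module.End.mem_maxGenEigenspace _ _ _).1 hw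
        refine (Module.End.mem_maxGenEigenspace _ _ _).2 ⟨s, ?_⟩
        have e : -HV - (k:ℂ) • 1 = -(HV - ((ν i : ℤ):ℂ) • 1) := by
          rw [hk]; push_cast; module
        rw [e, neg_pow]
        rw [Module.End.mul_apply, hs, map_zero]
  · intro a b ha hb
    rw [TensorProduct.tmul_add, map_add, ha, hb, add_zero]
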